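/- The semiring of 2-symmetric max-plus polynomials in the variables x_{1,1}, x_{1,2}, x_{2,1}, x_{2,2} is not finitely generated: there is no finite set S of 2-symmetric max-plus polynomial functions f : ℝ^4 → ℝ such that every 2-symmetric max-plus polynomial function ℝ^4 → ℝ belongs to the smallest set of functions ℝ^4 → ℝ containing S and all constant functions and closed under pointwise addition and pointwise maximum. -/

import Mathlib

/-- A max-plus polynomial function on `ℝ^N`:
`f x = max_{1 ≤ i ≤ m} (a_i + Σ_j c_{i,j} x_j)` with `a_i ∈ ℝ` and `c_{i,j} ∈ ℕ`. -/
def IsMaxPlusPoly (N : ℕ) (f : (Fin N → ℝ) → ℝ) : Prop :=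
  ∃ (m : ℕ) (a : Fin (m + 1) → ℝ) (c : Fin (m + 1) → Fin N → ℕ),
    ∀ x, f x = ⨆ i, (a i + ∑ j, (c i j : ℝ) * x j)

/-- The permutation of `(x_{1,1}, x_{1,2}, x_{2,1}, x_{2,2})` swapping the two blocks. -/
def blockSwap : Fin 4 → Fin 4 := ![2, 3, 0, 1]

/-- A function `f : ℝ⁴ → ℝ`, with arguments `(x_{1,1}, x_{1,2}, x_{2,1}, x_{2,2})`,
is 2-symmetric if it is invariant under swapping the two blocks of two variables. -/
def Is2Symmetric (f : (Fin 4 → ℝ) → ℝ) : Prop :=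
  ∀ x : Fin 4 → ℝ, f (fun i => x (blockSwap i)) = f x

/-- The smallest set of functions `ℝ⁴ → ℝ` containing a given set `S` and all constant
functions and closed under pointwise addition and pointwise maximum. -/
inductive GeneratedBy (S : Set ((Fin 4 → ℝ) → ℝ)) : ((Fin 4 → ℝ) → ℝ) → Prop
  | base {f} (hf : f ∈ S) : GeneratedBy S f
  | const (c : ℝ) : GeneratedBy S (fun _ => c)
  | add {f g} : GeneratedBy S f → GeneratedBy S g → GeneratedBy S (fun x => f x + g x)
  | max {f g} : GeneratedBy S f → GeneratedBy S g → GeneratedBy S (fun x => max (f x) (g x))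

/-- The exponents of the affine monomials lying below `f`, that is, the lattice points of the
Newton polytope when `f` is a max-plus polynomial function. -/
def newtonPoints (f : (Fin 4 → ℝ) → ℝ) : Set (Fin 4 → ℕ) :=
  {m | ∃ a : ℝ, ∀ x : Fin 4 → ℝ, a + ∑ j, (m j : ℝ) * x j ≤ f x}

/-- The 2-symmetric max-plus polynomial function `max (n x₁₁ + x₁₂) (n x₂₁ + x₂₂)`. -/
def primitiveSegment (n : ℕ) (x : Fin 4 → ℝ) : ℝ :=
  max (n * x 0 + x 1) (n * x 2 + x 3)

theorem isMaxPlusPoly_primitiveSegment (n : ℕ) : IsMaxPlusPoly 4 (primitiveSegment n) := by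
  refine ⟨1, 0, ![![n, 1, 0, 0], ![0, 0, n, 1]], fun x => ?_⟩
  have h : ∀ g : Fin 2 → ℝ, ⨆ i, g i = max (g 0) (g 1) := fun g => by
    rw [ciSup_eq_of_forall_le_of_forall_lt_exists_gt]
    · intro i; fin_cases i <;> simp
    · intro w hw
      rcases lt_max_iff.1 hw with h | h
      exacts [⟨0, h⟩, ⟨1, h⟩]
  rw [h]
  simp [primitiveSegment, Fin.sum_univ_four]

theorem is2Symmetric_primitiveSegment (n : ℕ) : Is2Symmetric (primitiveSegment n) := by
  intro x
  simp [primitiveSegment, blockSwap, max_comm]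

theorem IsMaxPlusPoly.newtonPoints_nonempty {f : (Fin 4 → ℝ) → ℝ} (hf : IsMaxPlusPoly 4 f) :
    (newtonPoints f).Nonempty := by
  obtain ⟨m, a, c, h⟩ := hf
  refine ⟨c 0, a 0, fun x => ?_⟩
  rw [h]
  exact le_ciSup (f := fun i => a i + ∑ j, (c i j : ℝ) * x j) (Set.finite_range _).bddAbove 0

theorem Is2Symmetric.swap_mem_newtonPoints {f : (Fin 4 → ℝ) → ℝ} (hf : Is2Symmetric f)
    {m : Fin 4 → ℕ} (hm : m ∈ newtonPoints f) : m ∘ blockSwap ∈ newtonPoints f := by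
  obtain ⟨a, h⟩ := hm
  refine ⟨a, fun x => ?_⟩
  have := h fun i => x (blockSwap i)
  rw [hf] at this
  simp [Fin.sum_univ_four, blockSwap] at this ⊢
  linarith

theorem add_mem_newtonPoints {f g : (Fin 4 → ℝ) → ℝ} {m k : Fin 4 → ℕ}
    (hm : m ∈ newtonPoints f) (hk : k ∈ newtonPoints g) :
    m + k ∈ newtonPoints fun x => f x + g x := by
  obtain ⟨a, ha⟩ := hm
  obtain ⟨b, hb⟩ := hk
  refine ⟨a + b, fun x => ?_⟩
  have := add_le_add (ha x) (hb x)
  simp only [Pi.add_apply, Nat.cast_add, add_mul, Finset.sum_add_distrib]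
  linarith

theorem newtonPoints_subset_max_left (f g : (Fin 4 → ℝ) → ℝ) :
    newtonPoints f ⊆ newtonPoints fun x => max (f x) (g x) :=
  fun _ ⟨a, ha⟩ => ⟨a, fun x => (ha x).trans (le_max_left _ _)⟩

theorem zero_mem_newtonPoints_const (c : ℝ) : 0 ∈ newtonPoints fun _ => c :=
  ⟨c, fun x => by simp⟩

theorem nonpos_of_forall_nat_mul_le {a b : ℝ} (h : ∀ t : ℕ, a + t * b ≤ 0) : b ≤ 0 := by
  by_contra! hb
  obtain ⟨t, ht⟩ := exists_nat_gt (-a / b)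
  rw [div_lt_iff₀ hb] at ht
  linarith [h t]

theorem sum_mul_le_of_mem_newtonPoints_primitiveSegment {n : ℕ} {m : Fin 4 → ℕ}
    (hm : m ∈ newtonPoints (primitiveSegment n)) (x : Fin 4 → ℝ) :
    ∑ j, (m j : ℝ) * x j ≤ primitiveSegment n x := by
  obtain ⟨a, ha⟩ := hm
  rw [← sub_nonpos]
  refine nonpos_of_forall_nat_mul_le (a := a) fun t => ?_
  have hs : primitiveSegment n ((t : ℝ) • x) = t * primitiveSegment n x := by
    simp only [primitiveSegment, Pi.smul_apply, smul_eq_mul,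
      mul_max_of_nonneg _ _ (Nat.cast_nonneg t : (0 : ℝ) ≤ t)]
    congr 1 <;> ring
  have h := ha ((t : ℝ) • x)
  rw [hs] at h
  have : ∑ j, (m j : ℝ) * ((t : ℝ) • x) j = t * ∑ j, (m j : ℝ) * x j := by
    rw [Finset.mul_sum]
    exact Finset.sum_congr rfl fun j _ => by simp only [Pi.smul_apply, smul_eq_mul]; ring
  linarith

/-- The segment from `(n, 1, 0, 0)` to `(0, 0, n, 1)` is primitive. -/
theorem newtonPoints_primitiveSegment_subset {n : ℕ} (hn : 0 < n) :
    newtonPoints (primitiveSegment n) ⊆ {![n, 1, 0, 0], ![0, 0, n, 1]} := by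
  intro m hm
  have key := sum_mul_le_of_mem_newtonPoints_primitiveSegment hm
  have h₁ := key ![1, -n, 0, 0]
  have h₂ := key ![-1, n, 0, 0]
  have h₃ := key ![0, 0, 1, -n]
  have h₄ := key ![0, 0, -1, n]
  have h₅ := key ![1, 0, 1, 0]
  have h₆ := key ![-1, 0, -1, 0]
  simp [primitiveSegment, Fin.sum_univ_four] at h₁ h₂ h₃ h₄ h₅ h₆
  have e₁ : m 0 = m 1 * n := by
    have : (m 0 : ℝ) = m 1 * n := by linarith
    exact_mod_cast this
  have e₂ : m 2 = m 3 * n := by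
    have : (m 2 : ℝ) = m 3 * n := by linarith
    exact_mod_cast this
  have e₃ : m 0 + m 2 = n := by
    have : (m 0 : ℝ) + m 2 = n := by linarith
    exact_mod_cast this
  have e₄ : m 1 + m 3 = 1 := by
    apply Nat.eq_of_mul_eq_mul_right hn
    rw [add_mul, ← e₁, ← e₂, e₃, one_mul]
  have : m 1 = 0 ∧ m 3 = 1 ∨ m 1 = 1 ∧ m 3 = 0 := by omega
  rcases this with ⟨h, h'⟩ | ⟨h, h'⟩
  · right
    ext i; fin_cases i <;> simp [e₁, e₂, h, h']
  · left
    ext i; fin_cases i <;> simp [e₁, e₂, h, h']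

/-- Of two lattice points such that both `p + q` and `p + swap q` are endpoints of the segment
from `(n, 1, 0, 0)` to `(0, 0, n, 1)`, one vanishes. -/
theorem eq_zero_or_eq_zero_of_add_mem {n : ℕ} {p q : Fin 4 → ℕ}
    (h : p + q ∈ ({![n, 1, 0, 0], ![0, 0, n, 1]} : Set (Fin 4 → ℕ)))
    (h' : p + q ∘ blockSwap ∈ ({![n, 1, 0, 0], ![0, 0, n, 1]} : Set (Fin 4 → ℕ))) :
    p = 0 ∨ q = 0 := by
  simp only [Set.mem_insert_iff, Set.mem_singleton_iff, funext_iff, Fin.forall_fin_succ,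
    blockSwap, Pi.add_apply] at h h' ⊢
  simp at h h' ⊢
  omega

theorem GeneratedBy.is2Symmetric {S : Set ((Fin 4 → ℝ) → ℝ)} (hS : ∀ f ∈ S, Is2Symmetric f)
    {f : (Fin 4 → ℝ) → ℝ} (hf : GeneratedBy S f) : Is2Symmetric f := by
  induction hf with
  | base hf => exact hS _ hf
  | const c => exact fun _ => rfl
  | add _ _ ihf ihg => exact fun x => congrArg₂ _ (ihf x) (ihg x)
  | max _ _ ihf ihg => exact fun x => congrArg₂ _ (ihf x) (ihg x)

theorem GeneratedBy.newtonPoints_nonempty {S : Set ((Fin 4 → ℝ) → ℝ)}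
    (hS : ∀ f ∈ S, (newtonPoints f).Nonempty)
    {f : (Fin 4 → ℝ) → ℝ} (hf : GeneratedBy S f) : (newtonPoints f).Nonempty := by
  induction hf with
  | base hf => exact hS _ hf
  | const c => exact ⟨0, zero_mem_newtonPoints_const c⟩
  | add _ _ ihf ihg => exact ⟨_, add_mem_newtonPoints ihf.some_mem ihg.some_mem⟩
  | max _ _ ihf _ => exact ihf.mono (newtonPoints_subset_max_left _ _)

theorem GeneratedBy.not_newtonPoints_subset {S : Set ((Fin 4 → ℝ) → ℝ)} {n : ℕ}
    (hsymm : ∀ f ∈ S, Is2Symmetric f) (hne : ∀ f ∈ S, (newtonPoints f).Nonempty)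
    (hS : ∀ f ∈ S, ¬ newtonPoints f ⊆ {![n, 1, 0, 0], ![0, 0, n, 1]})
    {f : (Fin 4 → ℝ) → ℝ} (hf : GeneratedBy S f) :
    ¬ newtonPoints f ⊆ {![n, 1, 0, 0], ![0, 0, n, 1]} := by
  induction hf with
  | base hf => exact hS _ hf
  | const c =>
    intro h
    have := h (zero_mem_newtonPoints_const c)
    simp [funext_iff, Fin.forall_fin_succ] at this
  | add hf hg ihf ihg =>
    intro h
    obtain ⟨p, hp⟩ := hf.newtonPoints_nonempty hne
    obtain ⟨q, hq⟩ := hg.newtonPoints_nonempty hne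
    have hq' := (hg.is2Symmetric hsymm).swap_mem_newtonPoints hq
    rcases eq_zero_or_eq_zero_of_add_mem (h (add_mem_newtonPoints hp hq))
      (h (add_mem_newtonPoints hp hq')) with rfl | rfl
    · exact ihg fun m hm => by simpa using h (add_mem_newtonPoints hp hm)
    · exact ihf fun m hm => by simpa using h (add_mem_newtonPoints hm hq)
  | max _ _ ihf _ => exact fun h => ihf ((newtonPoints_subset_max_left _ _).trans h)

/-- The semiring of 2-symmetric max-plus polynomials in the variables
`x_{1,1}, x_{1,2}, x_{2,1}, x_{2,2}` is not finitely generated. -/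
theorem two_symmetric_maxplus_not_finitely_generated :
    ¬ ∃ S : Set ((Fin 4 → ℝ) → ℝ), S.Finite ∧
        (∀ f ∈ S, IsMaxPlusPoly 4 f ∧ Is2Symmetric f) ∧
        (∀ f : (Fin 4 → ℝ) → ℝ, IsMaxPlusPoly 4 f → Is2Symmetric f → GeneratedBy S f) := by
  rintro ⟨S, hfin, hS, hgen⟩
  have hne : ∀ f ∈ S, (newtonPoints f).Nonempty := fun f hf => (hS f hf).1.newtonPoints_nonempty
  choose! p hp using hne
  obtain ⟨b, hb⟩ := (hfin.image fun f => p f 0 + p f 2).bddAbove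
  have hlt : ∀ f ∈ S, p f 0 + p f 2 < b + 1 := fun f hf =>
    Nat.lt_succ_of_le (hb (Set.mem_image_of_mem _ hf))
  refine GeneratedBy.not_newtonPoints_subset (n := b + 1) (fun f hf => (hS f hf).2)
    (fun f hf => ⟨p f, hp f hf⟩) (fun f hf h => ?_)
    (hgen _ (isMaxPlusPoly_primitiveSegment _) (is2Symmetric_primitiveSegment _))
    (newtonPoints_primitiveSegment_subset b.succ_pos)
  refine (hlt f hf).ne ?_
  rcases h (hp f hf) with e | e <;> rw [e] <;> simp
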